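/- arXiv:2310.11061 — 3 statements merged into one kernel-verified Lean document; each statement's English description precedes it below -/
import Mathlib

section
/- Let Ġ be a signed graph of order n with balanced clique number ω_b(Ġ). Then the largest eigenvalue of the adjacency matrix of Ġ satisfies λ₁(Ġ) ≤ (1 − 1/ω_b(Ġ))·n. -/
open scoped Classical

/-- A signed graph: a finite simple graph together with a symmetric sign function
taking value `1` or `-1` on every edge. -/
structure SignedGraph (V : Type*) where
  G : SimpleGraph V
  sign : V → V → ℤ
  sign_symm : ∀ u v, sign u v = sign v u
  sign_pm : ∀ u v, G.Adj u v → sign u v = 1 ∨ sign u v = -1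

namespace SignedGraph

variable {V : Type*} {W : Type*}

/-- The sign function on unordered pairs. -/
def edgeSign (SG : SignedGraph V) : Sym2 V → ℤ :=
  Sym2.lift ⟨SG.sign, SG.sign_symm⟩

/-- The sign of a walk: the product of the signs of its edges. -/
def walkSign (SG : SignedGraph V) {u v : V} (w : SG.G.Walk u v) : ℤ :=
  (w.edges.map SG.edgeSign).prod

/-- `Ġ` contains a negative cycle of length `l`. -/
def HasNegCycleLength (SG : SignedGraph V) (l : ℕ) : Prop :=
  ∃ (v : V) (w : SG.G.Walk v v), w.IsCycle ∧ w.length = l ∧ SG.walkSign w = -1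

/-- A signed graph is balanced if it is switching equivalent to the all-positive
signature on the same underlying graph. -/
def Balanced (SG : SignedGraph V) : Prop :=
  ∃ s : V → ℤ, (∀ x, s x = 1 ∨ s x = -1) ∧
    ∀ u v, SG.G.Adj u v → s u * SG.sign u v * s v = 1

/-- A signed graph is unbalanced if it is not balanced. -/
def Unbalanced (SG : SignedGraph V) : Prop := ¬ SG.Balanced

/-- The number of edges `e(Ġ)` of a signed graph. -/
noncomputable def edgeCount (SG : SignedGraph V) : ℕ := SG.G.edgeSet.ncard

/-- Switching equivalence of signed graphs (up to isomorphism of the underlying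
graphs): there is an isomorphism of the underlying graphs under which the two
signatures agree after a switching. -/
def SwitchEquiv (SG : SignedGraph V) (SH : SignedGraph W) : Prop :=
  ∃ (φ : SG.G ≃g SH.G) (s : V → ℤ), (∀ x, s x = 1 ∨ s x = -1) ∧
    ∀ u v, SG.G.Adj u v → SH.sign (φ u) (φ v) = s u * SG.sign u v * s v

end SignedGraph

namespace SignedGraph

variable {V : Type*}

/-- The adjacency matrix of a signed graph. -/
noncomputable def adjMatrix [Fintype V] (SG : SignedGraph V) : Matrix V V ℝ :=
  Matrix.of fun u v => if SG.G.Adj u v then (SG.sign u v : ℝ) else 0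

/-- The largest eigenvalue `λ₁` of the adjacency matrix of a signed graph. -/
noncomputable def lambdaMax [Fintype V] (SG : SignedGraph V) : ℝ :=
  sSup {μ : ℝ | ∃ x : V → ℝ, x ≠ 0 ∧ SG.adjMatrix.mulVec x = μ • x}

/-- The smallest eigenvalue `λₙ` of the adjacency matrix of a signed graph. -/
noncomputable def lambdaMin [Fintype V] (SG : SignedGraph V) : ℝ :=
  sInf {μ : ℝ | ∃ x : V → ℝ, x ≠ 0 ∧ SG.adjMatrix.mulVec x = μ • x}

/-- The spectral radius `ρ(Ġ) = max {λ₁(Ġ), -λₙ(Ġ)}` of a signed graph. -/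
noncomputable def specRadius [Fintype V] (SG : SignedGraph V) : ℝ :=
  max SG.lambdaMax (-SG.lambdaMin)

end SignedGraph

namespace SignedGraph

variable {V : Type*}

/-- The induced signed subgraph on a set of vertices. -/
def induce (SG : SignedGraph V) (S : Set V) : SignedGraph S where
  G := SG.G.induce S
  sign := fun a b => SG.sign a.1 b.1
  sign_symm := fun a b => SG.sign_symm a.1 b.1
  sign_pm := fun a b h => SG.sign_pm a.1 b.1 (by simpa using h)

/-- The balanced clique number `ω_b(Ġ)`: the maximum order of a balanced complete
subgraph of `Ġ`. -/
noncomputable def balancedCliqueNumber [Fintype V] (SG : SignedGraph V) : ℕ :=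
  sSup {m | ∃ S : Finset V, S.card = m ∧ SG.G.IsClique (S : Set V) ∧
    (SG.induce (S : Set V)).Balanced}

end SignedGraph

namespace SimpleGraph

open Matrix

variable {V : Type*} [Fintype V]

/-- Moving all the weight of a vertex `v` to a non-adjacent vertex `u` changes the quadratic form
of the adjacency matrix linearly. -/
lemma adjMatrix_quadForm_shift (H : SimpleGraph V) {u v : V} (huv : ¬ H.Adj u v)
    (y : V → ℝ) (t : ℝ) :
    (y + t • (Pi.single u 1 - Pi.single v 1)) ⬝ᵥ
        H.adjMatrix ℝ *ᵥ (y + t • (Pi.single u 1 - Pi.single v 1)) =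
      y ⬝ᵥ H.adjMatrix ℝ *ᵥ y +
        2 * t * ((H.adjMatrix ℝ *ᵥ y) u - (H.adjMatrix ℝ *ᵥ y) v) := by
  set d : V → ℝ := Pi.single u 1 - Pi.single v 1 with hd
  have hsymm : y ⬝ᵥ H.adjMatrix ℝ *ᵥ d = d ⬝ᵥ H.adjMatrix ℝ *ᵥ y := by
    rw [dotProduct_mulVec, ← mulVec_transpose, transpose_adjMatrix, dotProduct_comm]
  have hdy : d ⬝ᵥ H.adjMatrix ℝ *ᵥ y = (H.adjMatrix ℝ *ᵥ y) u - (H.adjMatrix ℝ *ᵥ y) v := by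
    rw [hd, sub_dotProduct, single_one_dotProduct, single_one_dotProduct]
  have hvu : ¬ H.Adj v u := fun h => huv h.symm
  have hdd : d ⬝ᵥ H.adjMatrix ℝ *ᵥ d = 0 := by
    rw [hd, sub_dotProduct, single_one_dotProduct, single_one_dotProduct, mulVec_sub]
    simp [huv, hvu]
  rw [mulVec_add, mulVec_smul, add_dotProduct, dotProduct_add, dotProduct_add, dotProduct_smul,
    smul_dotProduct, smul_dotProduct, dotProduct_smul, hsymm, hdd, hdy]
  simp only [smul_eq_mul]
  ring

/-- The Motzkin–Straus inequality for a weight whose support is a clique. -/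
lemma adjMatrix_quadForm_le_of_isClique_support (H : SimpleGraph V) {ω : ℕ} (y : V → ℝ)
    (hclique : H.IsClique (Function.support y))
    (hcard : (Finset.univ.filter fun i => y i ≠ 0).card ≤ ω) :
    y ⬝ᵥ H.adjMatrix ℝ *ᵥ y ≤ (1 - 1 / (ω : ℝ)) * (∑ i, y i) ^ 2 := by
  have hQ : y ⬝ᵥ H.adjMatrix ℝ *ᵥ y = (∑ i, y i) ^ 2 - ∑ i, y i ^ 2 := by
    have hrow (i : V) : y i * (H.adjMatrix ℝ *ᵥ y) i = y i * (∑ j, y j) - y i ^ 2 := by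
      have hi : y i ^ 2 = ∑ j, if i = j then y i * y j else 0 := by simp [sq]
      rw [hi, mulVec, dotProduct, Finset.mul_sum, Finset.mul_sum, ← Finset.sum_sub_distrib]
      refine Finset.sum_congr rfl fun j _ => ?_
      by_cases hij : i = j
      · simp [hij]
      by_cases hyi : y i = 0
      · simp [hyi]
      by_cases hyj : y j = 0
      · simp [hyj]
      simp [hij, hclique hyi hyj hij]
    simp only [dotProduct, hrow, Finset.sum_sub_distrib, ← Finset.sum_mul]
    ring
  have hcs : (∑ i, y i) ^ 2 ≤ (ω : ℝ) * ∑ i, y i ^ 2 := by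
    have h := sq_sum_le_card_mul_sum_sq (s := ({i | y i ≠ 0} : Finset V)) (f := y)
    have h1 : ∑ i with y i ≠ 0, y i = ∑ i, y i := Finset.sum_filter_ne_zero _
    have h2 : ∑ i with y i ≠ 0, y i ^ 2 ≤ ∑ i, y i ^ 2 :=
      Finset.sum_le_sum_of_subset_of_nonneg (Finset.filter_subset _ _)
        fun i _ _ => sq_nonneg (y i)
    rw [h1] at h
    exact h.trans (mul_le_mul (by exact_mod_cast hcard) h2
      (Finset.sum_nonneg fun i _ => sq_nonneg (y i)) (Nat.cast_nonneg _))
  have hdiv : (∑ i, y i) ^ 2 / (ω : ℝ) ≤ ∑ i, y i ^ 2 :=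
    div_le_of_le_mul₀ (Nat.cast_nonneg _) (Finset.sum_nonneg fun i _ => sq_nonneg (y i))
      (by linarith)
  rw [hQ, sub_mul, one_mul, one_div_mul_eq_div]
  linarith

/-- The **Motzkin–Straus inequality**. -/
theorem adjMatrix_quadForm_le (H : SimpleGraph V) {ω : ℕ}
    (hω : ∀ S : Finset V, H.IsClique (S : Set V) → S.card ≤ ω) (y : V → ℝ) (hy : 0 ≤ y) :
    y ⬝ᵥ H.adjMatrix ℝ *ᵥ y ≤ (1 - 1 / (ω : ℝ)) * (∑ i, y i) ^ 2 := by
  induction hk : (Finset.univ.filter fun i => y i ≠ 0).card using Nat.strong_induction_on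
    generalizing y with
  | _ k ih =>
  by_cases hclique : H.IsClique (Function.support y)
  · exact H.adjMatrix_quadForm_le_of_isClique_support y hclique
      (hω _ (by simpa [Function.support] using hclique))
  obtain ⟨u, hu, v, hv, huv, hadj, hle⟩ : ∃ u, y u ≠ 0 ∧ ∃ v, y v ≠ 0 ∧ u ≠ v ∧ ¬ H.Adj u v ∧
      (H.adjMatrix ℝ *ᵥ y) v ≤ (H.adjMatrix ℝ *ᵥ y) u := by
    simp only [IsClique, Set.Pairwise, Function.mem_support] at hclique
    push Not at hclique
    obtain ⟨u, hu, v, hv, huv, hadj⟩ := hclique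
    rcases le_total ((H.adjMatrix ℝ *ᵥ y) v) ((H.adjMatrix ℝ *ᵥ y) u) with h | h
    · exact ⟨u, hu, v, hv, huv, hadj, h⟩
    · exact ⟨v, hv, u, hu, huv.symm, fun h' => hadj h'.symm, h⟩
  set z : V → ℝ := y + y v • (Pi.single u 1 - Pi.single v 1) with hz
  have hzu : z u = y u + y v := by simp [hz, huv]
  have hzv : z v = 0 := by simp [hz, huv.symm]
  have hzi (i : V) (hiu : i ≠ u) (hiv : i ≠ v) : z i = y i := by simp [hz, hiu, hiv]
  have hz0 : 0 ≤ z := by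
    intro i
    by_cases hiv : i = v
    · simp [hiv, hzv]
    by_cases hiu : i = u
    · rw [hiu, hzu]; exact add_nonneg (hy u) (hy v)
    · rw [hzi i hiu hiv]; exact hy i
  have hcard : (Finset.univ.filter fun i => z i ≠ 0).card < k := by
    rw [← hk]
    refine Finset.card_lt_card ((Finset.ssubset_iff_of_subset fun i => ?_).2
      ⟨v, by simpa using hv, by simp [hzv]⟩)
    simp only [Finset.mem_filter, Finset.mem_univ, true_and]
    by_cases hiv : i = v
    · simp [hiv, hzv]
    by_cases hiu : i = u
    · simp [hiu, hu]
    · simp [hzi i hiu hiv]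
  have hsum : ∑ i, z i = ∑ i, y i := by
    simp [hz, Finset.sum_add_distrib, ← Finset.mul_sum]
  have hmain := ih _ hcard z hz0 rfl
  rw [hsum, hz, H.adjMatrix_quadForm_shift hadj] at hmain
  have := mul_nonneg (mul_nonneg zero_le_two (hy v)) (sub_nonneg.2 hle)
  linarith

end SimpleGraph

namespace SignedGraph

open Matrix

variable {V : Type*}

/-- The graph of the edges that become positive after switching by `s`. -/
def positiveGraph (SG : SignedGraph V) (s : V → ℤ) : SimpleGraph V where
  Adj u v := SG.G.Adj u v ∧ s u * SG.sign u v * s v = 1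
  symm := ⟨fun u v h => ⟨h.1.symm, by rw [SG.sign_symm, ← h.2]; ring⟩⟩
  loopless := ⟨fun u h => SG.G.loopless.irrefl u h.1⟩

variable [Fintype V]

lemma card_le_balancedCliqueNumber (SG : SignedGraph V) {s : V → ℤ}
    (hs : ∀ x, s x = 1 ∨ s x = -1) (S : Finset V)
    (hS : (SG.positiveGraph s).IsClique (S : Set V)) : S.card ≤ SG.balancedCliqueNumber := by
  refine le_csSup ⟨Fintype.card V, ?_⟩ ⟨S, rfl, fun u hu v hv huv => (hS hu hv huv).1,
    fun a => s a, fun a => hs a, fun a b hab => ?_⟩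
  · rintro _ ⟨T, rfl, -⟩
    exact T.card_le_univ
  · exact (hS a.2 b.2 fun h => hab.ne (Subtype.ext h)).2

/-- Switching by the signs of `x` and dropping the negative edges does not decrease the quadratic
form. -/
lemma quadForm_le_positiveGraph (SG : SignedGraph V) {s : V → ℤ}
    (hs : ∀ i, s i = 1 ∨ s i = -1) (x : V → ℝ) (hx : ∀ i, x i = s i * |x i|) :
    x ⬝ᵥ SG.adjMatrix *ᵥ x ≤ |x| ⬝ᵥ (SG.positiveGraph s).adjMatrix ℝ *ᵥ |x| := by
  simp only [dotProduct, mulVec, Finset.mul_sum]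
  refine Finset.sum_le_sum fun i _ => Finset.sum_le_sum fun j _ => ?_
  have hpos : (SG.positiveGraph s).Adj i j ↔ SG.G.Adj i j ∧ s i * SG.sign i j * s j = 1 := Iff.rfl
  rw [hx i, hx j, SimpleGraph.adjMatrix_apply]
  simp only [hpos, adjMatrix, of_apply, Pi.abs_apply]
  by_cases hij : SG.G.Adj i j
  · have h0 := mul_nonneg (abs_nonneg (x i)) (abs_nonneg (x j))
    rcases hs i with hi | hi <;> rcases hs j with hj | hj <;>
      rcases SG.sign_pm i j hij with h | h <;> simp [hij, hi, hj, h, h0]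
  · simp [hij]

lemma quadForm_le (SG : SignedGraph V) (x : V → ℝ) :
    x ⬝ᵥ SG.adjMatrix *ᵥ x ≤
      (1 - 1 / (SG.balancedCliqueNumber : ℝ)) * (∑ i, |x i|) ^ 2 := by
  let s : V → ℤ := fun i => if 0 ≤ x i then 1 else -1
  have hs (i : V) : s i = 1 ∨ s i = -1 := by
    by_cases h : 0 ≤ x i <;> simp [s, h]
  have hx (i : V) : x i = s i * |x i| := by
    by_cases h : 0 ≤ x i
    · simp [s, h, abs_of_nonneg h]
    · simp [s, h, abs_of_neg (not_le.1 h)]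
  exact (SG.quadForm_le_positiveGraph hs x hx).trans
    ((SG.positiveGraph s).adjMatrix_quadForm_le (SG.card_le_balancedCliqueNumber hs) |x|
      (abs_nonneg x))

end SignedGraph

/-- The bound of Wang, Yan and Qian: `λ₁(Ġ) ≤ (1 - 1/ω_b(Ġ)) · n` for a signed graph of
order `n` with balanced clique number `ω_b(Ġ)`. -/
theorem wang_yan_qian_bound {V : Type*} [Fintype V] (SG : SignedGraph V) (n : ℕ)
    (hn : Fintype.card V = n) :
    SG.lambdaMax ≤ (1 - 1 / (SG.balancedCliqueNumber : ℝ)) * (n : ℝ) := by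
  have hω : 0 ≤ 1 - 1 / (SG.balancedCliqueNumber : ℝ) := by
    rw [sub_nonneg, one_div]
    exact Nat.cast_inv_le_one _
  refine Real.sSup_le ?_ (mul_nonneg hω (Nat.cast_nonneg n))
  rintro μ ⟨x, hx, hμ⟩
  have hpos : 0 < ∑ i, x i ^ 2 := by
    obtain ⟨i, hi⟩ := Function.ne_iff.1 hx
    have hxi : x i ≠ 0 := hi
    exact Finset.sum_pos' (fun i _ => sq_nonneg (x i)) ⟨i, Finset.mem_univ i, by positivity⟩
  have hquad := SG.quadForm_le x
  rw [hμ, dotProduct_smul, smul_eq_mul] at hquad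
  have hdot : dotProduct x x = ∑ i, x i ^ 2 := by simp [dotProduct, sq]
  have hcs : (∑ i, |x i|) ^ 2 ≤ n * ∑ i, x i ^ 2 := by
    simpa [hn] using sq_sum_le_card_mul_sum_sq (s := Finset.univ) (f := fun i => |x i|)
  rw [hdot] at hquad
  refine le_of_mul_le_mul_right ?_ hpos
  rw [mul_assoc]
  exact hquad.trans (mul_le_mul_of_nonneg_left hcs hω)
end

section
/- Let Ġ = (G, σ) be an unbalanced signed graph of order n in which the minimum length of a negative cycle equals 5. Then e(Ġ) ≤ n(n−1)/2 − (2n−5). -/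
open scoped Classical

namespace SignedGraph

variable {V : Type*} {SG : SignedGraph V}

theorem sign_triangle (hmin : ∀ (u : V) (w : SG.G.Walk u u), w.IsCycle → SG.walkSign w = -1 →
      5 ≤ w.length) {a b c : V} (hab : SG.G.Adj a b) (hbc : SG.G.Adj b c) (hca : SG.G.Adj c a) :
    SG.sign a b * SG.sign b c * SG.sign c a = 1 := by
  by_contra h
  have hneg : SG.sign a b * SG.sign b c * SG.sign c a = -1 := by
    rcases SG.sign_pm _ _ hab with h1 | h1 <;> rcases SG.sign_pm _ _ hbc with h2 | h2 <;>
      rcases SG.sign_pm _ _ hca with h3 | h3 <;> simp_all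
  have := hmin a (.cons hab (.cons hbc (.cons hca .nil)))
    (by
      have := hab.ne
      have := hbc.ne
      have := hca.ne
      simp [SimpleGraph.Walk.cons_isCycle_iff]
      grind)
    (by simpa [walkSign, edgeSign, mul_assoc] using hneg)
  simp at this

theorem sign_quadrilateral
    (hmin : ∀ (u : V) (w : SG.G.Walk u u), w.IsCycle → SG.walkSign w = -1 → 5 ≤ w.length)
    {a b c d : V} (hab : SG.G.Adj a b) (hbc : SG.G.Adj b c) (hcd : SG.G.Adj c d)
    (hda : SG.G.Adj d a) (hac : a ≠ c) (hbd : b ≠ d) :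
    SG.sign a b * SG.sign b c * SG.sign c d * SG.sign d a = 1 := by
  by_contra h
  have hneg : SG.sign a b * SG.sign b c * SG.sign c d * SG.sign d a = -1 := by
    rcases SG.sign_pm _ _ hab with h1 | h1 <;> rcases SG.sign_pm _ _ hbc with h2 | h2 <;>
      rcases SG.sign_pm _ _ hcd with h3 | h3 <;> rcases SG.sign_pm _ _ hda with h4 | h4 <;>
      simp_all
  have := hmin a (.cons hab (.cons hbc (.cons hcd (.cons hda .nil))))
    (by
      have := hab.ne
      have := hbc.ne
      have := hcd.ne
      have := hda.ne
      simp [SimpleGraph.Walk.cons_isCycle_iff]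
      grind)
    (by simpa [walkSign, edgeSign, mul_assoc] using hneg)
  simp at this

/-- The vertices `a b c d e` form, in this cyclic order, a negative cycle of length five. -/
structure IsNegPentagon (SG : SignedGraph V) (a b c d e : V) : Prop where
  nodup : [a, b, c, d, e].Nodup
  adj_ab : SG.G.Adj a b
  adj_bc : SG.G.Adj b c
  adj_cd : SG.G.Adj c d
  adj_de : SG.G.Adj d e
  adj_ea : SG.G.Adj e a
  sign_eq : SG.sign a b * SG.sign b c * SG.sign c d * SG.sign d e * SG.sign e a = -1

theorem HasNegCycleLength.exists_isNegPentagon (h : SG.HasNegCycleLength 5) :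
    ∃ a b c d e, SG.IsNegPentagon a b c d e := by
  obtain ⟨a, w, hw, hl, hs⟩ := h
  match w, hl with
  | .cons (v := b) hab (.cons (v := c) hbc (.cons (v := d) hcd (.cons (v := e) hde
      (.cons hea .nil)))), _ =>
    refine ⟨a, b, c, d, e, ?_, hab, hbc, hcd, hde, hea, ?_⟩
    · have := hw.support_nodup
      simp at this ⊢
      grind
    · simpa [walkSign, edgeSign, mul_assoc] using hs

namespace IsNegPentagon

variable {a b c d e : V}

theorem rotate (h : SG.IsNegPentagon a b c d e) : SG.IsNegPentagon b c d e a where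
  nodup := by
    have := h.nodup
    grind
  adj_ab := h.adj_bc
  adj_bc := h.adj_cd
  adj_cd := h.adj_de
  adj_de := h.adj_ea
  adj_ea := h.adj_ab
  sign_eq := by linear_combination h.sign_eq

theorem not_adj_chord (h : SG.IsNegPentagon a b c d e)
    (hmin : ∀ (u : V) (w : SG.G.Walk u u), w.IsCycle → SG.walkSign w = -1 → 5 ≤ w.length) :
    ¬ SG.G.Adj a c := by
  intro hac
  have hn := h.nodup
  have h3 := sign_triangle hmin h.adj_ab h.adj_bc hac.symm
  have h4 := sign_quadrilateral hmin hac h.adj_cd h.adj_de h.adj_ea (by grind) (by grind)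
  have hs := h.sign_eq
  rw [SG.sign_symm c a] at h3
  rcases SG.sign_pm _ _ hac with h1 | h1 <;> rw [h1] at h3 h4 <;> grind

theorem not_adj_four (h : SG.IsNegPentagon a b c d e)
    (hmin : ∀ (u : V) (w : SG.G.Walk u u), w.IsCycle → SG.walkSign w = -1 → 5 ≤ w.length)
    {x : V} (hxe : x ≠ e) :
    ¬ (SG.G.Adj x a ∧ SG.G.Adj x b ∧ SG.G.Adj x c ∧ SG.G.Adj x d) := by
  rintro ⟨ha, hb, hc, hd⟩
  have hn := h.nodup
  have h1 := sign_triangle hmin ha h.adj_ab hb.symm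
  have h2 := sign_triangle hmin hb h.adj_bc hc.symm
  have h3 := sign_triangle hmin hc h.adj_cd hd.symm
  have h4 := sign_quadrilateral hmin hd h.adj_de h.adj_ea ha.symm hxe (by grind)
  have hs := h.sign_eq
  rw [SG.sign_symm b x] at h1
  rw [SG.sign_symm c x] at h2
  rw [SG.sign_symm d x] at h3
  rw [SG.sign_symm a x] at h4
  rcases SG.sign_pm _ _ ha with k1 | k1 <;> rcases SG.sign_pm _ _ hb with k2 | k2 <;>
    rcases SG.sign_pm _ _ hc with k3 | k3 <;> rcases SG.sign_pm _ _ hd with k4 | k4 <;>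
    rw [k1, k2] at h1 <;> rw [k2, k3] at h2 <;> rw [k3, k4] at h3 <;> rw [k4, k1] at h4 <;>
    grind

theorem two_le_card_not_adj (h : SG.IsNegPentagon a b c d e)
    (hmin : ∀ (u : V) (w : SG.G.Walk u u), w.IsCycle → SG.walkSign w = -1 → 5 ≤ w.length)
    {x : V} (hx : x ∉ ({a, b, c, d, e} : Finset V)) :
    2 ≤ (({a, b, c, d, e} : Finset V).filter fun y => ¬ SG.G.Adj x y).card := by
  have hn := h.nodup
  simp only [Finset.mem_insert, Finset.mem_singleton, not_or] at hx
  have h1 := h.not_adj_four hmin (x := x) (by tauto)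
  have h2 := h.rotate.not_adj_four hmin (x := x) (by tauto)
  have h3 := h.rotate.rotate.not_adj_four hmin (x := x) (by tauto)
  have h4 := h.rotate.rotate.rotate.not_adj_four hmin (x := x) (by tauto)
  have h5 := h.rotate.rotate.rotate.rotate.not_adj_four hmin (x := x) (by tauto)
  rw [Nat.succ_le_iff, Finset.one_lt_card]
  simp only [Finset.mem_filter, Finset.mem_insert, Finset.mem_singleton]
  simp only [List.nodup_cons, List.mem_cons, List.not_mem_nil, or_false, not_or] at hn
  by_cases ha : SG.G.Adj x a <;> by_cases hb : SG.G.Adj x b <;> by_cases hc : SG.G.Adj x c <;>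
    by_cases hd : SG.G.Adj x d <;> by_cases he : SG.G.Adj x e <;> grind

theorem card_compl_edgeFinset [Fintype V] (h : SG.IsNegPentagon a b c d e)
    (hmin : ∀ (u : V) (w : SG.G.Walk u u), w.IsCycle → SG.walkSign w = -1 → 5 ≤ w.length) :
    2 * Fintype.card V ≤ SG.Gᶜ.edgeFinset.card + 5 := by
  have hn := h.nodup
  have hac := h.not_adj_chord hmin
  have hbd := h.rotate.not_adj_chord hmin
  have hce := h.rotate.rotate.not_adj_chord hmin
  have hda := h.rotate.rotate.rotate.not_adj_chord hmin
  have heb := h.rotate.rotate.rotate.rotate.not_adj_chord hmin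
  set C : Finset V := {a, b, c, d, e} with hC
  have hCcard : C.card = 5 := by
    simpa [hC] using List.toFinset_card_of_nodup hn
  let chords : Finset (Sym2 V) := {s(a, c), s(b, d), s(c, e), s(d, a), s(e, b)}
  let cross : Finset (Σ _ : V, V) := Cᶜ.sigma fun x => C.filter fun y => ¬ SG.G.Adj x y
  have hchords : chords.card = 5 := by
    have : [s(a, c), s(b, d), s(c, e), s(d, a), s(e, b)].Nodup := by
      simp at hn ⊢
      grind
    simpa [chords] using List.toFinset_card_of_nodup this
  have hcross : 2 * (Fintype.card V - 5) ≤ cross.card := by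
    rw [Finset.card_sigma, mul_comm, ← hCcard, ← Finset.card_compl, ← smul_eq_mul]
    exact Finset.card_nsmul_le_sum _ _ _ fun x hx =>
      h.two_le_card_not_adj hmin (Finset.mem_compl.mp hx)
  have hinj : Set.InjOn (fun p : Σ _ : V, V => s(p.1, p.2)) cross := by
    rintro ⟨x, y⟩ hp ⟨x', y'⟩ hq heq
    simp only [cross, Finset.mem_coe, Finset.mem_sigma, Finset.mem_compl,
      Finset.mem_filter] at hp hq
    simp only [Sym2.eq_iff] at heq
    grind
  have hdisj : Disjoint chords (cross.image fun p => s(p.1, p.2)) := by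
    rw [Finset.disjoint_right]
    intro z hz hz'
    obtain ⟨⟨x, y⟩, hp, rfl⟩ := Finset.mem_image.mp hz
    simp only [cross, Finset.mem_sigma, Finset.mem_compl] at hp
    simp only [chords, Finset.mem_insert, Finset.mem_singleton, Sym2.eq_iff] at hz'
    simp only [hC, Finset.mem_insert, Finset.mem_singleton] at hp
    grind
  have hsub : chords ∪ cross.image (fun p => s(p.1, p.2)) ⊆ SG.Gᶜ.edgeFinset := by
    refine Finset.union_subset ?_ ?_
    · simp at hn
      simp only [chords, Finset.insert_subset_iff, Finset.singleton_subset_iff,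
        SimpleGraph.mem_edgeFinset, SimpleGraph.mem_edgeSet, SimpleGraph.compl_adj]
      grind
    · intro z hz
      obtain ⟨⟨x, y⟩, hp, rfl⟩ := Finset.mem_image.mp hz
      simp only [cross, Finset.mem_sigma, Finset.mem_compl, Finset.mem_filter] at hp
      simp only [SimpleGraph.mem_edgeFinset, SimpleGraph.mem_edgeSet, SimpleGraph.compl_adj]
      grind
  have := Finset.card_le_card hsub
  rw [Finset.card_union_of_disjoint hdisj, Finset.card_image_of_injOn hinj] at this
  omega

end IsNegPentagon

end SignedGraph


/-- If the minimum length of a negative cycle of an unbalanced signed graph of order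
`n` equals `5`, then `e(Ġ) ≤ n(n-1)/2 - (2n-5)`. -/
theorem min_neg_cycle_five_edge_bound {V : Type*} [Fintype V] (n : ℕ)
    (SG : SignedGraph V) (hn : Fintype.card V = n)
    (hex : SG.HasNegCycleLength 5)
    (hmin : ∀ (u : V) (w : SG.G.Walk u u), w.IsCycle → SG.walkSign w = -1 →
      5 ≤ w.length) :
    (SG.edgeCount : ℝ) ≤ (n : ℝ) * ((n : ℝ) - 1) / 2 - (2 * (n : ℝ) - 5) := by
  obtain ⟨a, b, c, d, e, h⟩ := hex.exists_isNegPentagon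
  have hcompl := h.card_compl_edgeFinset hmin
  have hsum : SG.G.edgeFinset.card + SG.Gᶜ.edgeFinset.card = n.choose 2 := by
    rw [← hn, ← SimpleGraph.card_edgeFinset_top_eq_card_choose_two,
      ← Finset.card_union_of_disjoint
        (SimpleGraph.disjoint_edgeFinset.mpr disjoint_compl_right)]
    congr 1
    ext z
    induction z with | _ x y
    simp only [Finset.mem_union, SimpleGraph.mem_edgeFinset, SimpleGraph.mem_edgeSet,
      SimpleGraph.compl_adj, SimpleGraph.top_adj]
    have := @SimpleGraph.Adj.ne _ SG.G x y
    tauto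
  have hcount : SG.edgeCount = SG.G.edgeFinset.card := by
    rw [SignedGraph.edgeCount, ← SimpleGraph.coe_edgeFinset, Set.ncard_coe_finset]
  rw [hn] at hcompl
  rw [hcount, ← Nat.cast_choose_two, ← hsum]
  have : (2 * n : ℝ) ≤ SG.Gᶜ.edgeFinset.card + 5 := mod_cast hcompl
  push_cast
  linarith
end

section
/- Let Ġ = (G, σ) be an unbalanced signed graph of order n in which the minimum length of a negative cycle equals c, where c ≥ 6. Then e(Ġ) ≤ n(n−1)/2 − ((n−2)c − n)/2. -/
open scoped Classical

namespace SignedGraph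

section Walks

variable {V : Type*} (SG : SignedGraph V)

@[simp]
theorem walkSign_nil (u : V) : SG.walkSign (SimpleGraph.Walk.nil : SG.G.Walk u u) = 1 := by
  simp [walkSign]

@[simp]
theorem walkSign_cons {u v w : V} (h : SG.G.Adj u v) (p : SG.G.Walk v w) :
    SG.walkSign (SimpleGraph.Walk.cons h p) = SG.sign u v * SG.walkSign p := by
  simp [walkSign, edgeSign]

@[simp]
theorem walkSign_append {u v w : V} (p : SG.G.Walk u v) (q : SG.G.Walk v w) :
    SG.walkSign (p.append q) = SG.walkSign p * SG.walkSign q := by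
  simp [walkSign]

@[simp]
theorem walkSign_reverse {u v : V} (p : SG.G.Walk u v) :
    SG.walkSign p.reverse = SG.walkSign p := by
  simp [walkSign, List.prod_reverse]

@[simp]
theorem walkSign_copy {u v u' v' : V} (p : SG.G.Walk u v) (hu : u = u') (hv : v = v') :
    SG.walkSign (p.copy hu hv) = SG.walkSign p := by
  simp [walkSign]

theorem walkSign_eq_one_or_neg_one {u v : V} (p : SG.G.Walk u v) :
    SG.walkSign p = 1 ∨ SG.walkSign p = -1 := by
  induction p with
  | nil => simp
  | cons h p ih =>
    rcases SG.sign_pm _ _ h with h₁ | h₁ <;> rcases ih with h₂ | h₂ <;> simp [h₁, h₂]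

variable {SG}

/-- If no closed walk of length at most `p.length` is negative, then shortening `p` to a path
preserves its sign. -/
theorem walkSign_bypass {u v : V} (p : SG.G.Walk u v)
    (hpos : ∀ (x : V) (q : SG.G.Walk x x), q.length ≤ p.length → SG.walkSign q ≠ -1) :
    SG.walkSign p.bypass = SG.walkSign p := by
  induction p with
  | nil => rfl
  | @cons u x v h p ih =>
    have hp := ih fun x q hq => hpos x q (by simp only [SimpleGraph.Walk.length_cons]; omega)
    rw [SimpleGraph.Walk.bypass]
    split_ifs with hs
    · have hspec := congrArg SG.walkSign (p.bypass.take_spec hs)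
      have hlen := congrArg SimpleGraph.Walk.length (p.bypass.take_spec hs)
      have hle := p.length_bypass_le_length
      have hcl := hpos u (.cons h (p.bypass.takeUntil u hs)) (by
        simp only [SimpleGraph.Walk.length_cons, SimpleGraph.Walk.length_append] at hlen ⊢
        omega)
      have hcl' := (SG.walkSign_eq_one_or_neg_one _).resolve_right hcl
      rw [walkSign_append] at hspec
      rw [walkSign_cons] at hcl' ⊢
      rw [← hp, ← hspec, ← mul_assoc, hcl', one_mul]
    · rw [walkSign_cons, walkSign_cons, hp]

/-- A lower bound for the lengths of the negative cycles is a lower bound for the lengths of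
the negative closed walks. -/
theorem le_length_of_walkSign_eq_neg_one {c : ℕ}
    (hmin : ∀ (u : V) (w : SG.G.Walk u u), w.IsCycle → SG.walkSign w = -1 → c ≤ w.length)
    {u : V} (w : SG.G.Walk u u) (hw : SG.walkSign w = -1) : c ≤ w.length := by
  induction hl : w.length using Nat.strong_induction_on generalizing u w with
  | _ l ih =>
  subst hl
  cases w with
  | nil => simp at hw
  | @cons _ x _ h p =>
    by_contra hlt
    simp only [SimpleGraph.Walk.length_cons] at ih hlt
    have hsign := walkSign_bypass p fun y q hq hneg => by
      have := ih q.length (by omega) q hneg rfl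
      omega
    rw [walkSign_cons, ← hsign] at hw
    have hle := p.length_bypass_le_length
    have hpath := p.bypass_isPath
    by_cases hmem : s(u, x) ∈ p.bypass.edges
    · have heq := hpath.eq_adj_toWalk_of_mem_edges (Sym2.eq_swap ▸ hmem)
      rw [heq] at hw
      simp only [SimpleGraph.Adj.toWalk, walkSign_cons, walkSign_nil, mul_one] at hw
      rw [SG.sign_symm x u] at hw
      nlinarith [mul_self_nonneg (SG.sign u x)]
    · have := hmin u (.cons h p.bypass)
        ((SimpleGraph.Walk.cons_isCycle_iff _ h).2 ⟨hpath, hmem⟩) (by rwa [walkSign_cons])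
      simp only [SimpleGraph.Walk.length_cons] at this
      omega

/-- A shortest negative closed walk is isometric: a walk between
two of its vertices is at least as long as one of the two arcs between them. -/
theorem length_ge_of_shortest_negative {c : ℕ}
    (hmin : ∀ (u : V) (w : SG.G.Walk u u), SG.walkSign w = -1 → c ≤ w.length)
    {u : V} {w : SG.G.Walk u u} (hlen : w.length = c) (hw : SG.walkSign w = -1)
    {i j : ℕ} (hij : i ≤ j) (hjc : j ≤ c) (q : SG.G.Walk (w.getVert i) (w.getVert j)) :
    j - i ≤ q.length ∨ c - (j - i) ≤ q.length := by
  obtain ⟨k, rfl⟩ := Nat.exists_eq_add_of_le hij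
  let a : SG.G.Walk (w.getVert i) (w.getVert (i + k)) :=
    ((w.drop i).take k).copy rfl (w.drop_getVert i k)
  let b : SG.G.Walk (w.getVert (i + k)) (w.getVert i) := (w.drop (i + k)).append (w.take i)
  have ha : a.length = k := by simp [a]; omega
  have hb : b.length = c - k := by simp [b]; omega
  have hab : SG.walkSign a * SG.walkSign b = -1 := by
    have h₁ : SG.walkSign w =
        SG.walkSign (w.take i) * SG.walkSign ((w.drop i).take k) *
          SG.walkSign (w.drop (i + k)) := by
      simp only [walkSign, SimpleGraph.Walk.edges_take, SimpleGraph.Walk.edges_drop,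
        ← List.prod_append, ← List.map_append]
      rw [← List.take_add, List.take_append_drop]
    simp only [a, b, walkSign_copy, walkSign_append]
    rw [← hw, h₁]
    ring
  have h₁ := hmin _ (q.append a.reverse)
  have h₂ := hmin _ (q.append b)
  simp only [walkSign_append, walkSign_reverse, SimpleGraph.Walk.length_append,
    SimpleGraph.Walk.length_reverse, ha, hb] at h₁ h₂
  rcases SG.walkSign_eq_one_or_neg_one a with hsa | hsa <;>
    rcases SG.walkSign_eq_one_or_neg_one b with hsb | hsb <;>
    rcases SG.walkSign_eq_one_or_neg_one q with hsq | hsq <;>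
    simp [hsa, hsb, hsq] at hab h₁ h₂ <;> omega

end Walks

end SignedGraph

/-- A set of at least `k` natural numbers contains an increasing sequence of length `k`. -/
theorem Finset.exists_strictMono_mem_of_le_card {T : Finset ℕ} {k : ℕ} (h : k ≤ T.card) :
    ∃ f : Fin k → ℕ, StrictMono f ∧ ∀ i, f i ∈ T := by
  obtain ⟨S, hST, hS⟩ := Finset.exists_subset_card_eq h
  exact ⟨S.orderEmbOfFin hS, (S.orderEmbOfFin hS).strictMono,
    fun i => hST (S.orderEmbOfFin_mem hS i)⟩

/-- At most two integers are cyclically adjacent to a given one modulo `c`. -/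
theorem card_le_two_of_cyclically_adjacent {c i : ℕ} (hc : 3 ≤ c) (hi : i < c) {T : Finset ℕ}
    (hT : ∀ j ∈ T, j < c)
    (hlow : ∀ j ∈ T, j ≤ i → 1 = i - j ∨ c - (i - j) ≤ 1)
    (hhigh : ∀ j ∈ T, i ≤ j → 1 = j - i ∨ c - (j - i) ≤ 1) : T.card ≤ 2 := by
  by_contra! h
  obtain ⟨f, hf, hfT⟩ := Finset.exists_strictMono_mem_of_le_card (k := 3) h
  have h₁ : f 0 < f 1 := hf (by decide)
  have h₂ : f 1 < f 2 := hf (by decide)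
  have := fun k => hT _ (hfT k)
  have := fun k => hlow _ (hfT k)
  have := fun k => hhigh _ (hfT k)
  grind

/-- A set of residues modulo `c ≥ 6` with pairwise cyclic distance at most two has at most three
elements. -/
theorem card_le_three_of_cyclic_dist_le_two {c : ℕ} (hc : 6 ≤ c) {T : Finset ℕ}
    (hT : ∀ j ∈ T, j < c)
    (hdist : ∀ i ∈ T, ∀ j ∈ T, i ≤ j → j - i ≤ 2 ∨ c - (j - i) ≤ 2) : T.card ≤ 3 := by
  by_contra! h
  obtain ⟨f, hf, hfT⟩ := Finset.exists_strictMono_mem_of_le_card (k := 4) h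
  have h₁ : f 0 < f 1 := hf (by decide)
  have h₂ : f 1 < f 2 := hf (by decide)
  have h₃ : f 2 < f 3 := hf (by decide)
  have h₄ := hT _ (hfT 3)
  have := hdist _ (hfT 0) _ (hfT 1) (by omega)
  have := hdist _ (hfT 1) _ (hfT 2) (by omega)
  have := hdist _ (hfT 2) _ (hfT 3) (by omega)
  have := hdist _ (hfT 0) _ (hfT 2) (by omega)
  have := hdist _ (hfT 1) _ (hfT 3) (by omega)
  have := hdist _ (hfT 0) _ (hfT 3) (by omega)
  omega

/-- A graph in which every vertex of `S` has at most two neighbours in `S`, and every other vertex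
at most three, has few edges. -/
theorem SimpleGraph.two_mul_card_edgeFinset_le {V : Type*} [Fintype V] (G : SimpleGraph V)
    (S : Finset V) (hin : ∀ v ∈ S, (S.filter (G.Adj v)).card ≤ 2)
    (hout : ∀ v ∈ Sᶜ, (S.filter (G.Adj v)).card ≤ 3) :
    2 * G.edgeFinset.card ≤ S.card * 2 + Sᶜ.card * 3 + Sᶜ.card * 3 +
      Sᶜ.card * (Sᶜ.card - 1) := by
  have hdeg : ∀ v, G.degree v = (S.filter (G.Adj v)).card + (Sᶜ.filter (G.Adj v)).card := by
    intro v
    rw [← G.card_neighborFinset_eq_degree, G.neighborFinset_eq_filter,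
      ← Finset.card_union_of_disjoint (Finset.disjoint_filter_filter disjoint_compl_right),
      ← Finset.filter_union, Finset.union_compl]
  have hcross : ∑ v ∈ S, (Sᶜ.filter (G.Adj v)).card = ∑ v ∈ Sᶜ, (S.filter (G.Adj v)).card := by
    simp only [Finset.card_filter]
    rw [Finset.sum_comm]
    simp only [G.adj_comm]
  have hcompl : ∀ v ∈ Sᶜ, (Sᶜ.filter (G.Adj v)).card ≤ Sᶜ.card - 1 := by
    intro v hv
    rw [← Finset.card_erase_of_mem hv]
    refine Finset.card_le_card fun x hx => ?_
    rw [Finset.mem_filter] at hx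
    exact Finset.mem_erase.2 ⟨hx.2.ne', hx.1⟩
  rw [← G.sum_degrees_eq_twice_card_edges, ← Finset.sum_add_sum_compl S]
  simp only [hdeg, Finset.sum_add_distrib]
  rw [hcross]
  have h₁ := Finset.sum_le_card_nsmul _ _ _ hin
  have h₂ := Finset.sum_le_card_nsmul _ _ _ hout
  have h₃ := Finset.sum_le_card_nsmul _ _ _ hcompl
  simp only [smul_eq_mul] at h₁ h₂ h₃
  omega

/-- If the minimum length of a negative cycle of an unbalanced signed graph of order
`n` equals `c ≥ 6`, then `e(Ġ) ≤ n(n-1)/2 - ((n-2)c - n)/2`. -/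
theorem min_neg_cycle_long_edge_bound {V : Type*} [Fintype V] (n c : ℕ)
    (SG : SignedGraph V) (hn : Fintype.card V = n) (hc : 6 ≤ c)
    (hex : SG.HasNegCycleLength c)
    (hmin : ∀ (u : V) (w : SG.G.Walk u u), w.IsCycle → SG.walkSign w = -1 →
      c ≤ w.length) :
    (SG.edgeCount : ℝ) ≤
      (n : ℝ) * ((n : ℝ) - 1) / 2 - (((n : ℝ) - 2) * (c : ℝ) - (n : ℝ)) / 2 := by
  obtain ⟨u, w, -, hlen, hw⟩ := hex
  have hdist : ∀ {i j : ℕ}, i ≤ j → j ≤ c → ∀ q : SG.G.Walk (w.getVert i) (w.getVert j),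
      j - i ≤ q.length ∨ c - (j - i) ≤ q.length := fun hij hjc q =>
    SignedGraph.length_ge_of_shortest_negative
      (fun _ => SignedGraph.le_length_of_walkSign_eq_neg_one hmin) hlen hw hij hjc q
  have hinj : Set.InjOn w.getVert (Finset.range c) := by
    suffices h : ∀ i j, i ≤ j → j < c → w.getVert i = w.getVert j → i = j by
      intro i hi j hj hij
      simp only [Finset.coe_range, Set.mem_Iio] at hi hj
      rcases le_total i j with hle | hle
      · exact h i j hle hj hij
      · exact (h j i hle hi hij.symm).symm
    intro i j hij hj heq
    have := hdist hij hj.le (SimpleGraph.Walk.nil.copy rfl heq)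
    simp only [SimpleGraph.Walk.length_copy, SimpleGraph.Walk.length_nil] at this
    omega
  set S : Finset V := (Finset.range c).image w.getVert with hS
  have hcard : S.card = c := by rw [hS, Finset.card_image_of_injOn hinj, Finset.card_range]
  have hindex : ∀ v, (S.filter (SG.G.Adj v)).card ≤
      ((Finset.range c).filter fun i => SG.G.Adj v (w.getVert i)).card := fun v => by
    rw [hS, Finset.filter_image]
    exact Finset.card_image_le
  have hin : ∀ v ∈ S, (S.filter (SG.G.Adj v)).card ≤ 2 := by
    intro v hv
    refine (hindex v).trans ?_
    obtain ⟨i, hi, rfl⟩ := Finset.mem_image.1 hv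
    rw [Finset.mem_range] at hi
    refine card_le_two_of_cyclically_adjacent (by omega) hi (by simp +contextual) ?_ ?_ <;>
      intro j hj hji <;> rw [Finset.mem_filter, Finset.mem_range] at hj
    · have hne : i ≠ j := fun h => hj.2.ne (by rw [h])
      have := hdist hji hi.le hj.2.symm.toWalk
      simp only [SimpleGraph.Walk.length_cons, SimpleGraph.Walk.length_nil,
        SimpleGraph.Adj.toWalk] at this
      omega
    · have hne : i ≠ j := fun h => hj.2.ne (by rw [h])
      have := hdist hji hj.1.le hj.2.toWalk
      simp only [SimpleGraph.Walk.length_cons, SimpleGraph.Walk.length_nil,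
        SimpleGraph.Adj.toWalk] at this
      omega
  have hout : ∀ v ∈ Sᶜ, (S.filter (SG.G.Adj v)).card ≤ 3 := by
    intro v _
    refine (hindex v).trans
      (card_le_three_of_cyclic_dist_le_two hc (by simp +contextual) fun i hi j hj hij => ?_)
    rw [Finset.mem_filter, Finset.mem_range] at hi hj
    simpa using hdist hij hj.1.le (.cons hi.2.symm hj.2.toWalk)
  have hedge := SG.G.two_mul_card_edgeFinset_le S hin hout
  have hcount : SG.edgeCount = SG.G.edgeFinset.card := by
    rw [SignedGraph.edgeCount, ← SimpleGraph.coe_edgeFinset, Set.ncard_coe_finset]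
  obtain ⟨m, hm⟩ : ∃ m, Sᶜ.card = m := ⟨_, rfl⟩
  have hnm : n = c + m := by rw [← hn, ← S.card_add_card_compl, hcard, hm]
  rw [hcard, hm, ← hcount] at hedge
  have hedge' : 2 * (SG.edgeCount : ℝ) ≤ c * 2 + m * 3 + m * 3 + m * (m - 1) := by
    rcases m with _ | m
    · simpa using (by exact_mod_cast hedge : 2 * (SG.edgeCount : ℝ) ≤ _)
    · rw [Nat.add_sub_cancel] at hedge
      have : 2 * (SG.edgeCount : ℝ) ≤ c * 2 + (m + 1) * 3 + (m + 1) * 3 + (m + 1) * m := by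
        exact_mod_cast hedge
      push_cast
      linarith
  have hcm : (6 : ℝ) * m ≤ c * m := by
    gcongr
    exact_mod_cast hc
  have hm₀ : (0 : ℝ) ≤ m := m.cast_nonneg
  rw [hnm]
  push_cast
  nlinarith
end
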